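/- Let f be analytic in the strip Y₁ ≤ Im z ≤ Y₂ of ℂ, fix z₁, z₂ with Im z₁ = Y₁, Im z₂ = Y₂, and for z in the open strip let γ_z be a smooth vertical curve from z₁ to z₂ passing through z. Then the function g(z) = (1/(2i)) ∫_{γ_z} cot(π(ζ - z - 0)) f(ζ) dζ (with the contour passing to the right of the pole at ζ = z) is analytic in Y₁ < Im z < Y₂ and satisfies g(z+1) - g(z) = f(z). -/

import Mathlib

open Real Filter

lemma aux_prim {V : Set ℂ} (hV : Convex ℝ V) {K : ℂ → ℂ} (hK : ∀ a ∈ V, AnalyticAt ℂ K a) :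
    ∃ H : ℂ → ℂ, ∀ a ∈ V, HasDerivWithinAt H (K a) V a := by
  have := hV.exists_forall_hasFDerivWithinAt_of_hasFDerivWithinAt_symmetric (𝕜 := ℂ)
    (ω := fun a => ContinuousLinearMap.toSpanSingleton ℂ (K a))
    (dω := fun a => ((ContinuousLinearMap.toSpanSingletonCLE (𝕜 := ℂ) (E := ℂ)).toContinuousLinearMap.comp
      (ContinuousLinearMap.toSpanSingleton ℂ (deriv K a))).restrictScalars ℝ) ?_ ?_
  · obtain ⟨H, hH⟩ := this
    exact ⟨H, fun a ha => hH a ha⟩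
  · intro a ha
    have h1 := (hK a ha).differentiableAt.hasDerivAt.hasFDerivAt
    have h2 := ((ContinuousLinearMap.toSpanSingletonCLE (𝕜 := ℂ) (E := ℂ)).toContinuousLinearMap.hasFDerivAt.comp a h1)
    exact (h2.restrictScalars ℝ).hasFDerivWithinAt
  · intro a ha x _ y _
    simp
    ring

lemma aux_ftc {V : Set ℂ} {K H : ℂ → ℂ} (hK : ContinuousOn K V)
    (hH : ∀ a ∈ V, HasDerivWithinAt H (K a) V a) {γ : ℝ → ℂ} (hγ : ContDiff ℝ 1 γ)
    (hm : ∀ t ∈ Set.Icc (0:ℝ) 1, γ t ∈ V) :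
    ∫ t in (0:ℝ)..1, K (γ t) * deriv γ t = H (γ 1) - H (γ 0) := by
  have hd : ∀ t ∈ Set.Icc (0:ℝ) 1, HasDerivWithinAt (fun t => H (γ t)) (K (γ t) * deriv γ t) (Set.Icc 0 1) t := by
    intro t ht
    have h1 : HasDerivAt γ (deriv γ t) t := (hγ.differentiable (by norm_num) t).hasDerivAt
    have := HasDerivWithinAt.scomp (𝕜 := ℝ) (𝕜' := ℂ) (h := γ) (g₁ := H) t (hH _ (hm t ht)) h1.hasDerivWithinAt hm
    simpa [mul_comm, Function.comp_def] using this
  apply intervalIntegral.integral_eq_sub_of_hasDerivAt_of_le (f := fun t => H (γ t)) zero_le_one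
  · exact fun t ht => (hd t ht).continuousWithinAt
  · intro t ht
    exact (hd t (Set.Ioo_subset_Icc_self ht)).hasDerivAt (Icc_mem_nhds ht.1 ht.2)
  · apply ContinuousOn.intervalIntegrable
    rw [Set.uIcc_of_le zero_le_one]
    exact (hK.comp hγ.continuous.continuousOn hm).mul (hγ.continuous_deriv (by norm_num)).continuousOn

lemma aux_lim {K0 A : ℂ → ℂ} {a : ℂ} (hA : AnalyticAt ℂ A a) (h : K0 =ᶠ[nhdsWithin a {a}ᶜ] A) :
    AnalyticAt ℂ (fun ζ => limUnder (nhdsWithin ζ {ζ}ᶜ) K0) a := by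
  have key : ∀ b, AnalyticAt ℂ A b → K0 =ᶠ[nhdsWithin b {b}ᶜ] A →
      limUnder (nhdsWithin b {b}ᶜ) K0 = A b := by
    intro b hb hb'
    apply Tendsto.limUnder_eq
    exact (hb.continuousAt.tendsto.mono_left nhdsWithin_le_nhds).congr' hb'.symm
  apply hA.congr
  have h1 := hA.eventually_analyticAt
  have h2 := (eventually_eventually_nhdsWithin (a := a) (s := {a}ᶜ)).2 h
  have h3 := eventually_nhdsWithin_iff.1 h2
  filter_upwards [h1, h3] with b hb1 hb3
  by_cases hba : b = a
  · subst hba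
    exact (key _ hA h).symm
  · refine (key _ hb1 ?_).symm
    have h4 : ∀ᶠ x in nhdsWithin b {a}ᶜ, K0 x = A x := hb3 hba
    rw [(isOpen_compl_singleton.nhdsWithin_eq (a := b) hba)] at h4
    exact h4.filter_mono nhdsWithin_le_nhds

/-- kernel -/
noncomputable def ck (s : ℂ) : ℂ := Complex.cos ((π : ℂ) * s) / Complex.sin ((π : ℂ) * s)

lemma sin_pi_eq_zero {s : ℂ} : Complex.sin ((π : ℂ) * s) = 0 ↔ ∃ n : ℤ, s = n := by
  rw [Complex.sin_eq_zero_iff]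
  have : (π : ℂ) ≠ 0 := by exact_mod_cast Real.pi_ne_zero
  constructor
  · rintro ⟨k, hk⟩
    refine ⟨k, mul_left_cancel₀ this (by rw [hk]; ring)⟩
  · rintro ⟨k, hk⟩
    exact ⟨k, by rw [hk]; ring⟩

lemma ck_per (s : ℂ) : ck (s - 1) = ck s := by
  unfold ck
  rw [mul_sub, mul_one, Complex.cos_sub_pi, Complex.sin_sub_pi, neg_div_neg_eq]

lemma ck_analytic {s : ℂ} (h : ∀ n : ℤ, s ≠ n) : AnalyticAt ℂ ck s := by
  unfold ck
  apply AnalyticAt.div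
  · fun_prop
  · fun_prop
  · intro h0
    obtain ⟨n, hn⟩ := sin_pi_eq_zero.1 h0
    exact h n hn

lemma aux_pole {f : ℂ → ℂ} {p : ℂ} (n : ℤ) (hf : AnalyticAt ℂ f (p + n)) :
    ∃ A : ℂ → ℂ, AnalyticAt ℂ A (p + n) ∧
      (fun ζ => ck (ζ - p) * f ζ - 1 / π * f (p + n) / (ζ - p - n)) =ᶠ[nhdsWithin (p+n) {p+(n:ℂ)}ᶜ] A := by
  set a : ℂ := p + n with ha
  have hpi : (π : ℂ) ≠ 0 := by exact_mod_cast Real.pi_ne_zero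
  set S : ℂ → ℂ := fun ζ => Complex.sin ((π : ℂ) * (ζ - p)) with hS
  set C : ℂ → ℂ := fun ζ => Complex.cos ((π : ℂ) * (ζ - p)) with hC
  have hSa : S a = 0 := sin_pi_eq_zero.2 ⟨n, by rw [ha]; ring⟩
  have hSan : AnalyticAt ℂ S a := by rw [hS]; fun_prop
  have hCan : AnalyticAt ℂ C a := by rw [hC]; fun_prop
  have hSd : HasDerivAt S (C a * π) a := by
    have h1 : HasDerivAt (fun ζ : ℂ => (π : ℂ) * (ζ - p)) π a := by
      simpa using ((hasDerivAt_id a).sub_const p).const_mul (π : ℂ)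
    exact h1.csin
  have hCa : C a ≠ 0 := by
    intro h0
    have := Complex.sin_sq_add_cos_sq ((π : ℂ) * (a - p))
    simp only [hS] at hSa
    simp only [hC] at h0
    rw [hSa, h0] at this
    simp at this
  set D := dslope S a with hD
  have hDan : AnalyticAt ℂ D a := by
    obtain ⟨q, hq⟩ := hSan
    exact hq.has_fpower_series_dslope_fslope.analyticAt
  have hDa : D a = C a * π := by rw [hD, dslope_same, hSd.deriv]
  have hDa0 : D a ≠ 0 := by rw [hDa]; exact mul_ne_zero hCa hpi
  set M : ℂ → ℂ := fun ζ => C ζ * f ζ - 1 / π * f a * D ζ with hM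
  have hMan : AnalyticAt ℂ M a := by rw [hM]; fun_prop
  have hMa : M a = 0 := by
    simp only [hM, hDa]; field_simp; ring
  refine ⟨fun ζ => dslope M a ζ / D ζ, ?_, ?_⟩
  · apply AnalyticAt.div _ hDan hDa0
    obtain ⟨q, hq⟩ := hMan
    exact hq.has_fpower_series_dslope_fslope.analyticAt
  · have h1 := hDan.continuousAt.eventually_ne hDa0
    filter_upwards [eventually_nhdsWithin_of_eventually_nhds h1, self_mem_nhdsWithin] with ζ h1 h2
    have h2' : ζ - a ≠ 0 := sub_ne_zero.2 h2
    have e1 : ζ - p - n = ζ - a := by rw [ha]; ring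
    have e2 : S ζ = (ζ - a) * D ζ := by
      have := sub_smul_dslope S a ζ
      rw [hSa, sub_zero, smul_eq_mul] at this
      exact this.symm
    have e3 : dslope M a ζ = M ζ / (ζ - a) := by
      have := sub_smul_dslope M a ζ
      rw [hMa, sub_zero, smul_eq_mul] at this
      rw [← this]; field_simp
    have e4 : ck (ζ - p) = C ζ / S ζ := rfl
    have e5 : M ζ = C ζ * f ζ - 1 / π * f a * D ζ := rfl
    simp only [e1, e3, e4, e2]
    rw [e5]
    field_simp

/-- position of the curve relative to the poles -/
def Side (γ : ℝ → ℂ) (p : ℂ) (m : ℤ) : Prop :=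
  ∀ t ∈ Set.Icc (0:ℝ) 1, (γ t).im = p.im → (m:ℝ) - 1 < (γ t).re - p.re ∧ (γ t).re - p.re < m

/-- log increments -/
noncomputable def TT (z₁ z₂ p : ℂ) (m n : ℤ) : ℂ :=
  if n < m then Complex.log (z₂ - p - n) - Complex.log (z₁ - p - n)
  else Complex.log (p + n - z₂) - Complex.log (p + n - z₁)

lemma Side.avoid {γ : ℝ → ℂ} {p : ℂ} {m : ℤ} (h : Side γ p m) {t : ℝ} (ht : t ∈ Set.Icc (0:ℝ) 1)
    (n : ℤ) : γ t - p ≠ n := by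
  intro h0
  have him := congrArg Complex.im h0
  have hre := congrArg Complex.re h0
  simp at him hre
  obtain ⟨h1, h2⟩ := h t ht (by linarith)
  rw [hre] at h1 h2
  have h1' : m - 1 < n := by exact_mod_cast h1
  have h2' : n < m := by exact_mod_cast h2
  omega

lemma aux_log {γ : ℝ → ℂ} (hγ : ContDiff ℝ 1 γ) {p : ℂ} {m : ℤ} (h : Side γ p m) (n : ℤ) :
    ∫ t in (0:ℝ)..1, (1 / (γ t - p - n)) * deriv γ t = TT (γ 0) (γ 1) p m n := by
  unfold TT
  split_ifs with hn
  · have hn' : (n:ℝ) ≤ m - 1 := by exact_mod_cast (by omega : n ≤ m - 1)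
    refine aux_ftc (V := {ζ | ζ - p - n ∈ Complex.slitPlane}) (K := fun ζ => 1 / (ζ - p - n))
      (H := fun ζ => Complex.log (ζ - p - n)) ?_ ?_ hγ ?_
    · intro a ha
      have : a - p - n ≠ 0 := Complex.slitPlane_ne_zero ha
      exact ContinuousAt.continuousWithinAt (by fun_prop (disch := assumption))
    · intro a ha
      have := (((hasDerivAt_id a).sub_const p).sub_const (n:ℂ)).clog ha
      exact this.hasDerivWithinAt
    · intro t ht
      simp only [Set.mem_ofPred_eq, Complex.mem_slitPlane_iff]
      by_cases him : (γ t).im = p.im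
      · left
        have := h t ht him
        simp
        linarith
      · right
        simpa [sub_eq_zero] using him
  · have hn' : (m:ℝ) ≤ n := by exact_mod_cast (by omega : m ≤ n)
    refine aux_ftc (V := {ζ | p + n - ζ ∈ Complex.slitPlane}) (K := fun ζ => 1 / (ζ - p - n))
      (H := fun ζ => Complex.log (p + n - ζ)) ?_ ?_ hγ ?_
    · intro a ha
      have h0 : p + n - a ≠ 0 := Complex.slitPlane_ne_zero ha
      have : a - p - n ≠ 0 := by
        intro h1; apply h0; linear_combination -h1
      exact ContinuousAt.continuousWithinAt (by fun_prop (disch := assumption))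
    · intro a ha
      have h0 : p + n - a ≠ 0 := Complex.slitPlane_ne_zero ha
      have := ((hasDerivAt_id a).const_sub (p + (n:ℂ))).clog ha
      have e : -1 / (p + n - a) = 1 / (a - p - n) := by
        rw [show a - p - n = -(p + n - a) by ring]
        field_simp
      rw [← e]
      exact this.hasDerivWithinAt
    · intro t ht
      simp only [Set.mem_ofPred_eq, Complex.mem_slitPlane_iff]
      by_cases him : (γ t).im = p.im
      · left
        have := h t ht him
        simp
        linarith
      · right
        simp only [Complex.sub_im, Complex.add_im, Complex.intCast_im, add_zero]
        intro h1; apply him; linarith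

lemma aux_formula {Y₁ Y₂ : ℝ} {f : ℂ → ℂ} (z₁ z₂ : ℂ)
    (hf : ∀ z : ℂ, Y₁ ≤ z.im → z.im ≤ Y₂ → AnalyticAt ℂ f z) {p : ℂ} (hp1 : Y₁ < p.im)
    (hp2 : p.im < Y₂) (N : ℕ) :
    ∃ C : ℂ, ∀ (γ : ℝ → ℂ) (m : ℤ), ContDiff ℝ 1 γ → γ 0 = z₁ → γ 1 = z₂ →
      (∀ t ∈ Set.Icc (0:ℝ) 1, Y₁ ≤ (γ t).im ∧ (γ t).im ≤ Y₂) →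
      (∀ t ∈ Set.Icc (0:ℝ) 1, |(γ t).re - p.re| ≤ N) → Side γ p m →
      ∫ t in (0:ℝ)..1, ck (γ t - p) * f (γ t) * deriv γ t =
        C + ∑ n ∈ Finset.Icc (-(N:ℤ)) N, 1 / π * f (p + n) * TT z₁ z₂ p m n := by
  set V : Set ℂ := {ζ | Y₁ ≤ ζ.im ∧ ζ.im ≤ Y₂ ∧ ζ.re ≤ p.re + N ∧ p.re - N ≤ ζ.re} with hV
  have hVc : Convex ℝ V := by
    have := (convex_halfSpace_im_ge Y₁).inter ((convex_halfSpace_im_le Y₂).inter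
      ((convex_halfSpace_re_le (p.re + N)).inter (convex_halfSpace_re_ge (p.re - N))))
    exact this
  set S := Finset.Icc (-(N:ℤ)) N with hS
  set K0 : ℂ → ℂ := fun ζ => ck (ζ - p) * f ζ - ∑ n ∈ S, 1 / π * f (p + n) / (ζ - p - n) with hK0
  have hsum : ∀ (a : ℂ) (S' : Finset ℤ), (∀ n ∈ S', a - p ≠ n) →
      AnalyticAt ℂ (fun ζ => ∑ n ∈ S', 1 / π * f (p + n) / (ζ - p - n)) a := by
    intro a S' h
    apply Finset.analyticAt_fun_sum
    intro n hn
    have : a - p - n ≠ 0 := sub_ne_zero.2 (h n hn)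
    exact AnalyticAt.div (by fun_prop) (by fun_prop) this
  have hreg : ∀ a, Y₁ ≤ a.im → a.im ≤ Y₂ → (∀ n : ℤ, a - p ≠ n) → AnalyticAt ℂ K0 a := by
    intro a h1 h2 h3
    apply AnalyticAt.sub _ (hsum a S fun n _ => h3 n)
    apply AnalyticAt.mul _ (hf a h1 h2)
    exact AnalyticAt.fun_comp (f := fun ζ => ζ - p) (g := ck) (ck_analytic h3) (by fun_prop)
  set K : ℂ → ℂ := fun ζ => limUnder (nhdsWithin ζ {ζ}ᶜ) K0 with hK
  have hKan : ∀ a ∈ V, AnalyticAt ℂ K a := by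
    intro a ha
    obtain ⟨h1, h2, h3, h4⟩ := ha
    by_cases hpole : ∀ n : ℤ, a - p ≠ n
    · exact aux_lim (hreg a h1 h2 hpole) EventuallyEq.rfl
    · push Not at hpole
      obtain ⟨n, hn⟩ := hpole
      have hn' : a = p + n := by rw [← hn]; ring
      have hnS : n ∈ S := by
        have hre := congrArg Complex.re hn
        simp at hre
        rw [hS, Finset.mem_Icc]
        constructor
        · have : -(N:ℝ) ≤ n := by linarith
          exact_mod_cast this
        · have : (n:ℝ) ≤ N := by linarith
          exact_mod_cast this
      obtain ⟨A, hA, hA'⟩ := aux_pole n (hn' ▸ hf a h1 h2 : AnalyticAt ℂ f (p + n))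
      rw [← hn'] at hA
      have hs := hsum a (S.erase n) (by
        intro k hk h
        rw [hn] at h
        exact (Finset.ne_of_mem_erase hk) (by exact_mod_cast h.symm))
      refine aux_lim (hA.sub hs) ?_
      rw [hn']
      filter_upwards [hA'] with ζ hζ
      simp only [hK0, Pi.sub_apply]
      rw [← hζ, ← Finset.add_sum_erase S _ hnS]
      ring
  obtain ⟨H, hH⟩ := aux_prim hVc hKan
  refine ⟨H z₂ - H z₁, ?_⟩
  intro γ m hγ h0 h1 him hre hside
  have hmem : ∀ t ∈ Set.Icc (0:ℝ) 1, γ t ∈ V := by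
    intro t ht
    have := abs_le.1 (hre t ht)
    exact ⟨(him t ht).1, (him t ht).2, by linarith, by linarith⟩
  have hI := aux_ftc (fun a ha => (hKan a ha).continuousAt.continuousWithinAt) hH hγ hmem
  rw [h0, h1] at hI
  rw [← hI]
  have hdc : Continuous (deriv γ) := hγ.continuous_deriv (by norm_num)
  have hlog : ∀ n ∈ S, 1 / π * f (p + n) * TT z₁ z₂ p m n =
      ∫ t in (0:ℝ)..1, 1 / π * f (p + n) * ((1 / (γ t - p - n)) * deriv γ t) := by
    intro n _
    rw [intervalIntegral.integral_const_mul, aux_log hγ hside n, h0, h1]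
  have hint : ∀ n ∈ S, IntervalIntegrable
      (fun t => 1 / π * f (p + n) * ((1 / (γ t - p - n)) * deriv γ t)) MeasureTheory.volume 0 1 := by
    intro n _
    apply ContinuousOn.intervalIntegrable
    rw [Set.uIcc_of_le zero_le_one]
    refine continuousOn_const.mul (ContinuousOn.mul (ContinuousOn.div continuousOn_const ?_ ?_) hdc.continuousOn)
    · have := hγ.continuous; fun_prop
    · intro t ht
      exact sub_ne_zero.2 (hside.avoid ht n)
  rw [Finset.sum_congr rfl hlog, ← intervalIntegral.integral_finsetSum hint,
    ← intervalIntegral.integral_add]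
  · apply intervalIntegral.integral_congr
    intro t ht
    rw [Set.uIcc_of_le zero_le_one] at ht
    have e : K (γ t) = K0 (γ t) := by
      apply Tendsto.limUnder_eq
      exact (hreg _ (him t ht).1 (him t ht).2 (fun n => hside.avoid ht n)).continuousAt.tendsto.mono_left
        nhdsWithin_le_nhds
    simp only [e, hK0]
    rw [sub_mul, Finset.sum_mul]
    have : ∀ n ∈ S, 1 / π * f (p + n) / (γ t - p - n) * deriv γ t =
      1 / π * f (p + n) * ((1 / (γ t - p - n)) * deriv γ t) := by
      intro n _; ring
    rw [Finset.sum_congr rfl this]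
    ring
  · apply ContinuousOn.intervalIntegrable
    rw [Set.uIcc_of_le zero_le_one]
    refine ContinuousOn.mul ?_ hdc.continuousOn
    exact ContinuousOn.comp (t := V) (g := K) (f := γ) (fun a ha => (hKan a ha).continuousAt.continuousWithinAt)
      hγ.continuous.continuousOn hmem
  · have := IntervalIntegrable.sum _ hint
    rw [Finset.sum_fn] at this
    exact this

lemma TT_jump {z₁ z₂ p : ℂ} (h1 : z₁.im < p.im) (h2 : p.im < z₂.im) :
    TT z₁ z₂ p 1 0 - TT z₁ z₂ p 0 0 = 2 * π * Complex.I := by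
  simp only [TT, zero_lt_one, if_true, lt_irrefl, if_false, Int.cast_zero, sub_zero, add_zero]
  have e1 : p - z₁ = -(z₁ - p) := by ring
  have e2 : p - z₂ = -(z₂ - p) := by ring
  have a1 := Complex.arg_neg_eq_arg_add_pi_of_im_neg (x := z₁ - p) (by simpa using h1)
  have a2 := Complex.arg_neg_eq_arg_sub_pi_of_im_pos (x := z₂ - p) (by simpa using h2)
  rw [e1, e2]
  simp only [Complex.log, norm_neg, a1, a2]
  push_cast
  ring

/-- admissible curve -/
structure Good (Y₁ Y₂ : ℝ) (z₁ z₂ : ℂ) (γ : ℝ → ℂ) : Prop where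
  cd : ContDiff ℝ 1 γ
  h0 : γ 0 = z₁
  h1 : γ 1 = z₂
  im : ∀ t ∈ Set.Icc (0:ℝ) 1, Y₁ ≤ (γ t).im ∧ (γ t).im ≤ Y₂

lemma Good.bdd {Y₁ Y₂ : ℝ} {z₁ z₂ : ℂ} {γ : ℝ → ℂ} (h : Good Y₁ Y₂ z₁ z₂ γ) (p : ℂ) :
    ∃ R : ℝ, ∀ t ∈ Set.Icc (0:ℝ) 1, |(γ t).re - p.re| ≤ R := by
  have hc : Continuous fun t => (γ t).re - p.re := by
    have := h.cd.continuous; fun_prop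
  exact isCompact_Icc.exists_bound_of_continuousOn hc.continuousOn

lemma aux_two {Y₁ Y₂ : ℝ} {f : ℂ → ℂ} {z₁ z₂ : ℂ}
    (hf : ∀ z : ℂ, Y₁ ≤ z.im → z.im ≤ Y₂ → AnalyticAt ℂ f z) {p : ℂ} (hp1 : Y₁ < p.im)
    (hp2 : p.im < Y₂) {γ δ : ℝ → ℂ} (hγ : Good Y₁ Y₂ z₁ z₂ γ) (hδ : Good Y₁ Y₂ z₁ z₂ δ) {m k : ℤ}
    (sγ : Side γ p m) (sδ : Side δ p k) :
    ∃ N : ℕ, (∫ t in (0:ℝ)..1, ck (γ t - p) * f (γ t) * deriv γ t) -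
      (∫ t in (0:ℝ)..1, ck (δ t - p) * f (δ t) * deriv δ t) =
      ∑ n ∈ Finset.Icc (-(N:ℤ)) N, 1 / π * f (p + n) * (TT z₁ z₂ p m n - TT z₁ z₂ p k n) := by
  obtain ⟨R₁, hR₁⟩ := hγ.bdd p
  obtain ⟨R₂, hR₂⟩ := hδ.bdd p
  obtain ⟨N, hN⟩ := exists_nat_ge (max R₁ R₂)
  refine ⟨N, ?_⟩
  obtain ⟨C, hC⟩ := aux_formula z₁ z₂ hf hp1 hp2 N
  rw [hC γ m hγ.cd hγ.h0 hγ.h1 hγ.im (fun t ht => (hR₁ t ht).trans ((le_max_left _ _).trans hN)) sγ,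
    hC δ k hδ.cd hδ.h0 hδ.h1 hδ.im (fun t ht => (hR₂ t ht).trans ((le_max_right _ _).trans hN)) sδ,
    add_sub_add_left_eq_sub, ← Finset.sum_sub_distrib]
  simp only [mul_sub]

lemma aux_same {Y₁ Y₂ : ℝ} {f : ℂ → ℂ} {z₁ z₂ : ℂ}
    (hf : ∀ z : ℂ, Y₁ ≤ z.im → z.im ≤ Y₂ → AnalyticAt ℂ f z) {p : ℂ} (hp1 : Y₁ < p.im)
    (hp2 : p.im < Y₂) {γ δ : ℝ → ℂ} (hγ : Good Y₁ Y₂ z₁ z₂ γ) (hδ : Good Y₁ Y₂ z₁ z₂ δ) {m : ℤ}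
    (sγ : Side γ p m) (sδ : Side δ p m) :
    (∫ t in (0:ℝ)..1, ck (γ t - p) * f (γ t) * deriv γ t) =
      (∫ t in (0:ℝ)..1, ck (δ t - p) * f (δ t) * deriv δ t) := by
  obtain ⟨N, hN⟩ := aux_two hf hp1 hp2 hγ hδ sγ sδ
  simpa [sub_eq_zero] using hN

lemma aux_jump {Y₁ Y₂ : ℝ} {f : ℂ → ℂ} {z₁ z₂ : ℂ} (hz₁ : z₁.im = Y₁) (hz₂ : z₂.im = Y₂)
    (hf : ∀ z : ℂ, Y₁ ≤ z.im → z.im ≤ Y₂ → AnalyticAt ℂ f z) {p : ℂ} (hp1 : Y₁ < p.im)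
    (hp2 : p.im < Y₂) {γ δ : ℝ → ℂ} (hγ : Good Y₁ Y₂ z₁ z₂ γ) (hδ : Good Y₁ Y₂ z₁ z₂ δ)
    (sγ : Side γ p 1) (sδ : Side δ p 0) :
    (∫ t in (0:ℝ)..1, ck (γ t - p) * f (γ t) * deriv γ t) -
      (∫ t in (0:ℝ)..1, ck (δ t - p) * f (δ t) * deriv δ t) = 2 * Complex.I * f p := by
  obtain ⟨N, hN⟩ := aux_two hf hp1 hp2 hγ hδ sγ sδ
  have hpi : (π : ℂ) ≠ 0 := by exact_mod_cast Real.pi_ne_zero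
  rw [hN, Finset.sum_eq_single 0, TT_jump (by rwa [hz₁]) (by rwa [hz₂])]
  · simp; field_simp
  · intro n _ hn
    have : TT z₁ z₂ p 1 n = TT z₁ z₂ p 0 n := by
      unfold TT
      by_cases h : n < 0
      · rw [if_pos h, if_pos (by omega)]
      · rw [if_neg h, if_neg (by omega)]
    rw [this, sub_self, mul_zero]
  · intro h
    exact absurd (Finset.mem_Icc.2 ⟨by omega, by omega⟩) h

lemma aux_param {γ : ℝ → ℂ} (hγ : ContDiff ℝ 1 γ) {f : ℂ → ℂ}
    (hf : ∀ t ∈ Set.Icc (0:ℝ) 1, ContinuousAt f (γ t)) {W : Set ℂ} (hW : IsOpen W)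
    (hav : ∀ w ∈ W, ∀ t ∈ Set.Icc (0:ℝ) 1, ∀ n : ℤ, γ t - w ≠ n) :
    DifferentiableOn ℂ (fun w => ∫ t in (0:ℝ)..1, ck (γ t - w) * f (γ t) * deriv γ t) W := by
  intro w hw
  apply DifferentiableAt.differentiableWithinAt
  obtain ⟨ε, hε, hball⟩ := Metric.nhds_basis_closedBall.mem_iff.1 (hW.mem_nhds hw)
  have hc := hγ.continuous
  have hdc : Continuous (deriv γ) := hγ.continuous_deriv (by norm_num)
  have hfc : ContinuousOn (fun t => f (γ t) * deriv γ t) (Set.Icc 0 1) := by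
    intro t ht
    have h1 : ContinuousAt (fun t => f (γ t)) t := ContinuousAt.comp (f := γ) (g := f) (hf t ht) hc.continuousAt
    exact (h1.mul hdc.continuousAt).continuousWithinAt
  set F' : ℂ → ℝ → ℂ := fun w t => -deriv ck (γ t - w) * (f (γ t) * deriv γ t) with hF'
  have hF : ∀ w ∈ W, ContinuousOn (fun t => ck (γ t - w) * f (γ t) * deriv γ t) (Set.Icc 0 1) := by
    intro w hw
    simp only [mul_assoc]
    apply ContinuousOn.mul _ hfc
    intro t ht
    have := (ck_analytic (hav w hw t ht)).continuousAt
    exact (ContinuousAt.comp (f := fun t => γ t - w) (g := ck) this (by fun_prop)).continuousWithinAt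
  have hF'c : ContinuousOn (Function.uncurry F') (Metric.closedBall w ε ×ˢ Set.Icc 0 1) := by
    apply ContinuousOn.mul
    · rintro ⟨v, t⟩ ⟨hv, ht⟩
      have := (ck_analytic (hav v (hball hv) t ht)).deriv.continuousAt
      exact (ContinuousAt.comp (f := fun x : ℂ × ℝ => γ x.2 - x.1) (g := deriv ck) (x := (v, t)) this
        (by fun_prop)).neg.continuousWithinAt
    · exact hfc.comp (f := fun x : ℂ × ℝ => x.2) continuous_snd.continuousOn (fun x hx => hx.2)
  obtain ⟨B, hB⟩ := ((isCompact_closedBall w ε).prod isCompact_Icc).exists_bound_of_continuousOn hF'c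
  have hsub : Set.uIoc (0:ℝ) 1 ⊆ Set.Icc 0 1 := by
    rw [Set.uIoc_of_le zero_le_one]; exact Set.Ioc_subset_Icc_self
  have hmeas : ∀ h : ℝ → ℂ, ContinuousOn h (Set.Icc 0 1) →
      MeasureTheory.AEStronglyMeasurable h (MeasureTheory.volume.restrict (Set.uIoc (0:ℝ) 1)) := by
    intro h hh
    exact (hh.mono hsub).aestronglyMeasurable measurableSet_uIoc
  refine (intervalIntegral.hasDerivAt_integral_of_dominated_loc_of_deriv_le (F' := F')
    (bound := fun _ => B) (Metric.closedBall_mem_nhds w hε) ?_ ?_ ?_ ?_ ?_ ?_).2.differentiableAt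
  · filter_upwards [hW.mem_nhds hw] with v hv
    exact hmeas _ (hF v hv)
  · apply ContinuousOn.intervalIntegrable
    rw [Set.uIcc_of_le zero_le_one]
    exact hF w hw
  · apply hmeas
    exact hF'c.comp (f := fun t : ℝ => (w, t)) (by fun_prop)
      (fun t ht => ⟨Metric.mem_closedBall_self hε.le, ht⟩)
  · refine Eventually.of_forall fun t ht v hv => ?_
    exact hB (v, t) ⟨hv, hsub ht⟩
  · exact intervalIntegrable_const
  · refine Eventually.of_forall fun t ht v hv => ?_
    have h1 := (ck_analytic (hav v (hball hv) t (hsub ht))).differentiableAt.hasDerivAt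
    have h2 := h1.comp v ((hasDerivAt_id v).const_sub (γ t))
    have h3 := h2.mul_const (f (γ t) * deriv γ t)
    simp only [mul_assoc, hF']
    have e : -deriv ck (γ t - v) * (f (γ t) * deriv γ t) =
      deriv ck (γ t - v) * (-1) * (f (γ t) * deriv γ t) := by ring
    rw [e]
    exact h3

theorem stmt4
    (Y₁ Y₂ : ℝ) (hY : Y₁ < Y₂) (f g : ℂ → ℂ) (z₁ z₂ : ℂ)
    (hz₁ : z₁.im = Y₁) (hz₂ : z₂.im = Y₂)
    (hf : ∀ z : ℂ, Y₁ ≤ z.im → z.im ≤ Y₂ → AnalyticAt ℂ f z)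
    (hg : ∀ z : ℂ, Y₁ < z.im → z.im < Y₂ →
      ∃ γ : ℝ → ℂ, ContDiff ℝ 1 γ ∧ γ 0 = z₁ ∧ γ 1 = z₂ ∧
        StrictMonoOn (fun t => (γ t).im) (Set.Icc 0 1) ∧
        (∃ t₀ ∈ Set.Ioo (0 : ℝ) 1, γ t₀ = z) ∧
        Tendsto (fun d : ℝ =>
            (1 / (2 * Complex.I)) * ∫ t in (0 : ℝ)..1,
              (Complex.cos ((π : ℂ) * (γ t - z - (d : ℂ))) /
                Complex.sin ((π : ℂ) * (γ t - z - (d : ℂ)))) * f (γ t) * deriv γ t)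
          (nhdsWithin 0 (Set.Ioi 0)) (nhds (g z))) :
    (∀ z : ℂ, Y₁ < z.im → z.im < Y₂ → AnalyticAt ℂ g z) ∧
      ∀ z : ℂ, Y₁ < z.im → z.im < Y₂ → g (z + 1) - g z = f z := by
  have hg' : ∀ z : ℂ, Y₁ < z.im → z.im < Y₂ → ∃ γ : ℝ → ℂ, Good Y₁ Y₂ z₁ z₂ γ ∧
      (∀ t ∈ Set.Icc (0:ℝ) 1, (γ t).im = z.im → γ t = z) ∧
      Tendsto (fun d : ℝ => (1 / (2 * Complex.I)) *
        ∫ t in (0 : ℝ)..1, ck (γ t - z - d) * f (γ t) * deriv γ t)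
        (nhdsWithin 0 (Set.Ioi 0)) (nhds (g z)) := by
    intro z h1 h2
    obtain ⟨γ, hc, h0, h1, hmono, ⟨t₀, ht₀, hz⟩, hT⟩ := hg z h1 h2
    refine ⟨γ, ⟨hc, h0, h1, ?_⟩, ?_, hT⟩
    · intro t ht
      have m1 := hmono.monotoneOn (Set.left_mem_Icc.2 zero_le_one) ht ht.1
      have m2 := hmono.monotoneOn ht (Set.right_mem_Icc.2 zero_le_one) ht.2
      simp only [h0, h1, hz₁, hz₂] at m1 m2
      exact ⟨m1, m2⟩
    · intro t ht him
      rw [← hz]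
      congr 1
      apply hmono.injOn ht (Set.Ioo_subset_Icc_self ht₀)
      simp only [him, hz]
  clear hg
  constructor
  · intro z h1 h2
    obtain ⟨γ, hγ, hγz, -⟩ := hg' (z - 1 / 2) (by simpa using h1) (by simpa using h2)
    have hcont := hγ.cd.continuous
    have hev : ∀ᶠ w in nhds z, Side γ w 0 := by
      refine isCompact_Icc.eventually_forall_of_forall_eventually
        (P := fun (w : ℂ) (t : ℝ) => (γ t).im = w.im → ((0:ℤ):ℝ) - 1 < (γ t).re - w.re ∧ (γ t).re - w.re < ((0:ℤ):ℝ)) ?_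
      intro t ht
      by_cases him : (γ t).im = z.im
      · have e := hγz t ht (by simpa using him)
        have o1 : ∀ᶠ x : ℂ × ℝ in nhds (z, t), -1 < (γ x.2).re - x.1.re :=
          Filter.Tendsto.eventually_const_lt (by simp only [e]; norm_num) (ContinuousAt.tendsto (x := (z, t)) (f := fun x : ℂ × ℝ => (γ x.2).re - x.1.re) (by fun_prop))
        have o2 : ∀ᶠ x : ℂ × ℝ in nhds (z, t), (γ x.2).re - x.1.re < 0 :=
          Filter.Tendsto.eventually_lt_const (by simp only [e]; norm_num) (ContinuousAt.tendsto (x := (z, t)) (f := fun x : ℂ × ℝ => (γ x.2).re - x.1.re) (by fun_prop))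
        filter_upwards [o1, o2] with x a b _
        simpa using And.intro a (by linarith)
      · have o : ∀ᶠ x : ℂ × ℝ in nhds (z, t), (γ x.2).im - x.1.im ≠ 0 :=
          ContinuousAt.eventually_ne (by fun_prop) (sub_ne_zero.2 him)
        filter_upwards [o] with x a b
        exact absurd (sub_eq_zero.2 b) a
    have hs1 : ∀ᶠ w in nhds z, Y₁ < w.im := Complex.continuous_im.continuousAt.eventually_const_lt h1
    have hs2 : ∀ᶠ w in nhds z, w.im < Y₂ := Complex.continuous_im.continuousAt.eventually_lt_const h2
    obtain ⟨W, hWp, hWo, hzW⟩ := eventually_nhds_iff.1 (hev.and (hs1.and hs2))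
    have hG := (aux_param hγ.cd (fun t ht => (hf _ (hγ.im t ht).1 (hγ.im t ht).2).continuousAt) hWo
      (fun w hw t ht n => (hWp w hw).1.avoid ht n)).const_mul (1 / (2 * Complex.I))
    refine (DifferentiableOn.congr hG ?_).analyticAt (hWo.mem_nhds hzW)
    intro w hw
    obtain ⟨δ, hδ, hδw, hT⟩ := hg' w (hWp w hw).2.1 (hWp w hw).2.2
    refine tendsto_nhds_unique hT ?_
    have hcw := (hG.differentiableAt (hWo.mem_nhds hw)).continuousAt
    have hadd : Tendsto (fun d : ℝ => w + (d:ℂ)) (nhdsWithin 0 (Set.Ioi 0)) (nhds w) := by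
      have : ContinuousAt (fun d : ℝ => w + (d:ℂ)) 0 := by fun_prop
      have h := this.tendsto
      simp only [Complex.ofReal_zero, add_zero] at h
      exact h.mono_left nhdsWithin_le_nhds
    refine (hcw.tendsto.comp hadd).congr' ?_
    filter_upwards [hadd.eventually (hWo.mem_nhds hw), Ioo_mem_nhdsGT (zero_lt_one (α := ℝ))] with d hdW hd
    simp only [Function.comp_apply]
    congr 1
    have sd : Side δ (w + d) 0 := by
      intro t ht him
      rw [hδw t ht (by simpa using him)]
      simpa using hd.symm
    rw [aux_same hf (hWp _ hdW).2.1 (hWp _ hdW).2.2 hγ hδ (hWp _ hdW).1 sd]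
    simp only [sub_sub]
  · intro z h1 h2
    obtain ⟨γ, hγ, hγz, hTγ⟩ := hg' (z + 1) (by simpa using h1) (by simpa using h2)
    obtain ⟨δ, hδ, hδz, hTδ⟩ := hg' z h1 h2
    refine tendsto_nhds_unique (hTγ.sub hTδ) ?_
    have hadd : Tendsto (fun d : ℝ => f (z + (d:ℂ))) (nhdsWithin 0 (Set.Ioi 0)) (nhds (f z)) := by
      have hfz : ContinuousAt f (z + ((0:ℝ):ℂ)) := by simpa using (hf z h1.le h2.le).continuousAt
      have : ContinuousAt (fun d : ℝ => f (z + (d:ℂ))) 0 :=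
        ContinuousAt.comp (f := fun d : ℝ => z + (d:ℂ)) (g := f) hfz (by fun_prop)
      have h := this.tendsto
      simp only [Complex.ofReal_zero, add_zero] at h
      exact h.mono_left nhdsWithin_le_nhds
    refine hadd.congr' ?_
    filter_upwards [Ioo_mem_nhdsGT (zero_lt_one (α := ℝ))] with d hd
    have sγ : Side γ (z + d) 1 := by
      intro t ht him
      rw [hγz t ht (by simpa using him)]
      obtain ⟨a, b⟩ := hd
      simp
      constructor <;> linarith
    have sδ : Side δ (z + d) 0 := by
      intro t ht him
      rw [hδz t ht (by simpa using him)]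
      simpa using hd.symm
    have hj := aux_jump hz₁ hz₂ hf (p := z + d) (by simpa using h1) (by simpa using h2) hγ hδ sγ sδ
    have eγ : ∀ t, ck (γ t - (z + 1) - d) = ck (γ t - (z + d)) := by
      intro t
      rw [← ck_per (γ t - (z + d))]
      congr 1; ring
    have eδ : ∀ t, ck (δ t - z - d) = ck (δ t - (z + d)) := by
      intro t; rw [sub_sub]
    simp only [eγ, eδ]
    rw [← mul_sub, hj]
    have := Complex.I_ne_zero
    field_simp
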